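/- For the symmetric or weakly asymmetric random walk (p_N = 1/2 + c/N with c ≥ 0), let k ≥ 1, let 0 < α₁ < α₂ < ⋯ < α_k < 1, let e₁,…,e_k ∈ {0,1}, and let α ∈ (0,1) with α ∉ {α₁,…,α_k}. Then, conditionally on all sites ⌊α_i N⌋ being visited before exit, the parities of their local times converge to independent fair Bernoulli variables: lim_{N→∞} P_{⌊αN⌋}( ∩_{i=1}^k {G(⌊α_i N⌋) ≡ e_i mod 2} | max_{1≤i≤k} T_{⌊α_i N⌋} < τ_N ) = 1/2^k. -/

import Mathlib

open Filter Topology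

/-- Position of the nearest-neighbor walk after the steps `w` (`true` = one step right,
`false` = one step left), started from `x`. -/
def walkPos (x : ℤ) (w : List Bool) : ℤ :=
  x + (w.count true : ℤ) - (w.count false : ℤ)

/-- `w` is the step sequence of a trajectory on `{0, 1, …, N}` started at `x` and run
exactly until the exit time `τ_N = T_0 ∧ T_N`: all positions strictly before the last
step lie strictly inside `(0, N)`, and the final position is `0` or `N`. -/
def IsExitPath (N : ℕ) (x : ℤ) (w : List Bool) : Prop :=
  (∀ k < w.length, 0 < walkPos x (w.take k) ∧ walkPos x (w.take k) < (N : ℤ)) ∧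
    (walkPos x w = 0 ∨ walkPos x w = (N : ℤ))

/-- Probability weight of the step sequence `w` when each step goes right with
probability `p` and left with probability `1 - p`, independently. -/
noncomputable def wt (p : ℝ) (w : List Bool) : ℝ :=
  p ^ w.count true * (1 - p) ^ w.count false

/-- `prob N p x S` is the probability, for the walk on `{0, …, N}` with right-step
probability `p` started at `x` and stopped at the exit time `τ_N`, that its stopped
trajectory (recorded as the step sequence up to time `τ_N`) satisfies `S`. -/
noncomputable def prob (N : ℕ) (p : ℝ) (x : ℤ) (S : List Bool → Prop) : ℝ :=
  ∑' w : List Bool, Set.indicator {w | IsExitPath N x w ∧ S w} (wt p) w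

/-- Expectation of `f` of the stopped trajectory for the walk started at `x`. -/
noncomputable def expect (N : ℕ) (p : ℝ) (x : ℤ) (f : List Bool → ℝ) : ℝ :=
  ∑' w : List Bool, Set.indicator {w | IsExitPath N x w} (fun w => wt p w * f w) w

/-- Probability for the walk whose starting point is uniformly distributed on
`{0, 1, …, N}`; the event `S` may depend on the starting point. -/
noncomputable def probUniform (N : ℕ) (p : ℝ) (S : ℤ → List Bool → Prop) : ℝ :=
  (∑ x ∈ Finset.range (N + 1), prob N p (x : ℤ) (S (x : ℤ))) / (N + 1)

/-- The set of sites visited by the stopped walk up to time `τ_N` (time `0` included). -/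
def rangeSet (x : ℤ) (w : List Bool) : Finset ℤ :=
  (Finset.range (w.length + 1)).image fun k => walkPos x (w.take k)

/-- The range `R_N`: the number of distinct sites visited up to the exit time. -/
def rangeCount (x : ℤ) (w : List Bool) : ℕ := (rangeSet x w).card

/-- The local time `G(y) = Σ_{k=0}^{τ_N} 1_{X_k = y}` of the stopped trajectory `w`. -/
def localTime (x y : ℤ) (w : List Bool) : ℕ :=
  ((Finset.range (w.length + 1)).filter fun k => walkPos x (w.take k) = y).card

/-- The event `T_y < τ_N`: the walk started at `x` visits `y` at some time
`k ≥ 1` strictly before the end of the stopped trajectory `w`. -/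
def hitsBefore (x y : ℤ) (w : List Bool) : Prop :=
  ∃ k, 1 ≤ k ∧ k < w.length ∧ walkPos x (w.take k) = y


/-- one step of the walk -/
def nxt (x : ℤ) (b : Bool) : ℤ := if b then x + 1 else x - 1

lemma walkPos_nil (x : ℤ) : walkPos x [] = x := by simp [walkPos]

lemma walkPos_cons (x : ℤ) (b : Bool) (w : List Bool) :
    walkPos x (b :: w) = walkPos (nxt x b) w := by
  cases b <;> simp [walkPos, nxt] <;> ring

lemma exit_nil (N : ℕ) (x : ℤ) : IsExitPath N x [] ↔ (x = 0 ∨ x = N) := by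
  simp [IsExitPath, walkPos_nil]

lemma exit_cons (N : ℕ) (x : ℤ) (b : Bool) (w : List Bool) :
    IsExitPath N x (b :: w) ↔ (0 < x ∧ x < N) ∧ IsExitPath N (nxt x b) w := by
  unfold IsExitPath
  rw [walkPos_cons, ← and_assoc]
  refine and_congr_left fun _ => ?_
  constructor
  · intro h
    refine ⟨?_, ?_⟩
    · simpa [walkPos_nil] using h 0 (by simp)
    · intro k hk
      have := h (k + 1) (by simpa using hk)
      simpa [walkPos_cons] using this
  · rintro ⟨h0, h⟩ k hk
    cases k with
    | zero => simpa [walkPos_nil] using h0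
    | succ k =>
      have := h k (by simpa using hk)
      simpa [walkPos_cons] using this

/-- weight restricted to exit paths -/
noncomputable def exW (N : ℕ) (p : ℝ) (x : ℤ) (w : List Bool) : ℝ :=
  Set.indicator {w | IsExitPath N x w} (wt p) w

lemma wt_cons_true (p : ℝ) (w : List Bool) : wt p (true :: w) = p * wt p w := by
  simp [wt, pow_succ]; ring

lemma wt_cons_false (p : ℝ) (w : List Bool) : wt p (false :: w) = (1 - p) * wt p w := by
  simp [wt, pow_succ]; ring

lemma exW_true (N : ℕ) (p : ℝ) (x : ℤ) (hx : 0 < x ∧ x < N) (w : List Bool) :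
    exW N p x (true :: w) = p * exW N p (x + 1) w := by
  have h := exit_cons N x true w
  by_cases h' : IsExitPath N (x + 1) w
  · have h2 : IsExitPath N x (true :: w) := h.2 ⟨hx, by simpa [nxt] using h'⟩
    simp [exW, h', h2, wt_cons_true]
  · have h2 : ¬ IsExitPath N x (true :: w) := fun h3 => h' (by simpa [nxt] using (h.1 h3).2)
    simp [exW, h', h2]

lemma exW_false (N : ℕ) (p : ℝ) (x : ℤ) (hx : 0 < x ∧ x < N) (w : List Bool) :
    exW N p x (false :: w) = (1 - p) * exW N p (x - 1) w := by
  have h := exit_cons N x false w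
  by_cases h' : IsExitPath N (x - 1) w
  · have h2 : IsExitPath N x (false :: w) := h.2 ⟨hx, by simpa [nxt] using h'⟩
    simp [exW, h', h2, wt_cons_false]
  · have h2 : ¬ IsExitPath N x (false :: w) := fun h3 => h' (by simpa [nxt] using (h.1 h3).2)
    simp [exW, h', h2]

lemma exW_cons_out (N : ℕ) (p : ℝ) (x : ℤ) (hx : ¬ (0 < x ∧ x < N)) (b : Bool) (w : List Bool) :
    exW N p x (b :: w) = 0 := by
  have h2 : ¬ IsExitPath N x (b :: w) := fun h3 => hx ((exit_cons N x b w).1 h3).1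
  simp [exW, h2]

lemma exW_nil_in (N : ℕ) (p : ℝ) (x : ℤ) (hx : 0 < x ∧ x < N) : exW N p x [] = 0 := by
  have h2 : ¬ IsExitPath N x [] := by rw [exit_nil]; omega
  simp [exW, h2]

lemma exW_nil_bd (N : ℕ) (p : ℝ) (x : ℤ) (hx : x = 0 ∨ x = N) : exW N p x [] = 1 := by
  have h2 : IsExitPath N x [] := by rw [exit_nil]; omega
  simp [exW, h2, wt]

lemma exW_nil_le (N : ℕ) (p : ℝ) (x : ℤ) : exW N p x [] ≤ 1 := by
  by_cases h2 : IsExitPath N x [] <;> simp [exW, h2, wt]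

lemma exW_nonneg (N : ℕ) (p : ℝ) (h0 : 0 ≤ p) (h1 : p ≤ 1) (x : ℤ) (w : List Bool) :
    0 ≤ exW N p x w := by
  unfold exW
  apply Set.indicator_nonneg
  intro w _
  unfold wt
  have : 0 ≤ 1 - p := by linarith
  positivity

/-- lists of length less than `n` -/
def shortL : ℕ → Finset (List Bool)
  | 0 => ∅
  | n + 1 => insert [] ((shortL n).image (List.cons true) ∪ (shortL n).image (List.cons false))

lemma mem_shortL (n : ℕ) (w : List Bool) (h : w.length < n) : w ∈ shortL n := by
  induction n generalizing w with
  | zero => simp at h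
  | succ n ih =>
    cases w with
    | nil => simp [shortL]
    | cons b w =>
      have := ih w (by simpa using h)
      cases b <;> simp [shortL, this]

lemma sum_shortL_succ (n : ℕ) (f : List Bool → ℝ) :
    ∑ w ∈ shortL (n + 1), f w =
      f [] + (∑ w ∈ shortL n, f (true :: w) + ∑ w ∈ shortL n, f (false :: w)) := by
  rw [shortL, Finset.sum_insert (by simp), Finset.sum_union, Finset.sum_image, Finset.sum_image]
  · intro a _ b _ h; simpa using h
  · intro a _ b _ h; simpa using h
  · rw [Finset.disjoint_left]
    intro a ha hb
    simp only [Finset.mem_image] at ha hb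
    obtain ⟨u, _, rfl⟩ := ha
    obtain ⟨v, _, hv⟩ := hb
    simp at hv

lemma sum_shortL_le (N : ℕ) (p : ℝ) (h0 : 0 ≤ p) (h1 : p ≤ 1) (n : ℕ) (x : ℤ) :
    ∑ w ∈ shortL n, exW N p x w ≤ 1 := by
  induction n generalizing x with
  | zero => simp [shortL]
  | succ n ih =>
    rw [sum_shortL_succ]
    by_cases hx : 0 < x ∧ x < N
    · simp only [exW_true N p x hx, exW_false N p x hx, exW_nil_in N p x hx, ← Finset.mul_sum]
      have := mul_le_mul_of_nonneg_left (ih (x + 1)) h0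
      have := mul_le_mul_of_nonneg_left (ih (x - 1)) (sub_nonneg.2 h1)
      linarith
    · simp only [exW_cons_out N p x hx]
      simpa using exW_nil_le N p x

lemma sum_exW_le (N : ℕ) (p : ℝ) (h0 : 0 ≤ p) (h1 : p ≤ 1) (x : ℤ) (F : Finset (List Bool)) :
    ∑ w ∈ F, exW N p x w ≤ 1 := by
  refine le_trans ?_ (sum_shortL_le N p h0 h1 (F.sup List.length + 1) x)
  apply Finset.sum_le_sum_of_subset_of_nonneg
  · intro w hw
    exact mem_shortL _ _ (Nat.lt_succ_of_le (Finset.le_sup (f := List.length) hw))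
  · intro w _ _; exact exW_nonneg N p h0 h1 x w

lemma summable_exW (N : ℕ) (p : ℝ) (h0 : 0 ≤ p) (h1 : p ≤ 1) (x : ℤ) :
    Summable (exW N p x) :=
  summable_of_sum_le (exW_nonneg N p h0 h1 x) (sum_exW_le N p h0 h1 x)

lemma tsum_exW_le (N : ℕ) (p : ℝ) (h0 : 0 ≤ p) (h1 : p ≤ 1) (x : ℤ) :
    ∑' w, exW N p x w ≤ 1 :=
  (summable_exW N p h0 h1 x).tsum_le_of_sum_le (sum_exW_le N p h0 h1 x)

/-- expectation functional -/
noncomputable def EE (N : ℕ) (p : ℝ) (x : ℤ) (F : List Bool → ℝ) : ℝ :=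
  ∑' w, exW N p x w * F w

/-- bounded functional -/
def Bd (F : List Bool → ℝ) : Prop := ∃ C, ∀ w, |F w| ≤ C

lemma summable_EE (N : ℕ) (p : ℝ) (h0 : 0 ≤ p) (h1 : p ≤ 1) (x : ℤ) (F : List Bool → ℝ)
    (hF : Bd F) : Summable fun w => exW N p x w * F w := by
  obtain ⟨C, hC⟩ := hF
  refine Summable.of_norm_bounded ((summable_exW N p h0 h1 x).mul_right C) fun w => ?_
  rw [norm_mul, Real.norm_eq_abs, Real.norm_eq_abs, abs_of_nonneg (exW_nonneg N p h0 h1 x w)]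
  exact mul_le_mul_of_nonneg_left (hC w) (exW_nonneg N p h0 h1 x w)

lemma EE_abs_le (N : ℕ) (p : ℝ) (h0 : 0 ≤ p) (h1 : p ≤ 1) (x : ℤ) (F : List Bool → ℝ)
    (hF : ∀ w, |F w| ≤ 1) : |EE N p x F| ≤ 1 := by
  have hs := summable_EE N p h0 h1 x F ⟨1, hF⟩
  unfold EE
  rw [← Real.norm_eq_abs]
  refine (norm_tsum_le_tsum_norm hs.norm).trans ?_
  refine le_trans ?_ (tsum_exW_le N p h0 h1 x)
  refine Summable.tsum_le_tsum (fun w => ?_) hs.norm (summable_exW N p h0 h1 x)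
  rw [norm_mul, Real.norm_eq_abs, Real.norm_eq_abs, abs_of_nonneg (exW_nonneg N p h0 h1 x w)]
  exact mul_le_of_le_one_right (exW_nonneg N p h0 h1 x w) (hF w)

lemma EE_lin (N : ℕ) (p : ℝ) (h0 : 0 ≤ p) (h1 : p ≤ 1) (x : ℤ) (F G : List Bool → ℝ)
    (hF : Bd F) (hG : Bd G) (a b : ℝ) :
    EE N p x (fun w => a * F w + b * G w) = a * EE N p x F + b * EE N p x G := by
  unfold EE
  rw [← tsum_mul_left, ← tsum_mul_left, ← Summable.tsum_add]
  · congr 1; ext w; ring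
  · exact (summable_EE N p h0 h1 x F hF).mul_left a
  · exact (summable_EE N p h0 h1 x G hG).mul_left b

lemma EE_sub (N : ℕ) (p : ℝ) (h0 : 0 ≤ p) (h1 : p ≤ 1) (x : ℤ) (F G : List Bool → ℝ)
    (hF : Bd F) (hG : Bd G) :
    EE N p x (fun w => F w - G w) = EE N p x F - EE N p x G := by
  have := EE_lin N p h0 h1 x F G hF hG 1 (-1)
  rw [show (fun w => F w - G w) = fun w => 1 * F w + (-1) * G w by ext; ring, this]; ring

lemma EE_mono (N : ℕ) (p : ℝ) (h0 : 0 ≤ p) (h1 : p ≤ 1) (x : ℤ) (F G : List Bool → ℝ)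
    (hF : Bd F) (hG : Bd G) (h : ∀ w, IsExitPath N x w → F w ≤ G w) :
    EE N p x F ≤ EE N p x G := by
  unfold EE
  refine Summable.tsum_le_tsum (fun w => ?_) (summable_EE N p h0 h1 x F hF)
    (summable_EE N p h0 h1 x G hG)
  by_cases hw : IsExitPath N x w
  · exact mul_le_mul_of_nonneg_left (h w hw) (exW_nonneg N p h0 h1 x w)
  · simp [exW, hw]

lemma EE_congr (N : ℕ) (p : ℝ) (x : ℤ) (F G : List Bool → ℝ)
    (h : ∀ w, IsExitPath N x w → F w = G w) : EE N p x F = EE N p x G := by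
  unfold EE
  congr 1; ext w
  by_cases hw : IsExitPath N x w
  · rw [h w hw]
  · simp [exW, hw]

open Classical in
lemma prob_eq (N : ℕ) (p : ℝ) (x : ℤ) (S : List Bool → Prop) :
    prob N p x S = EE N p x (fun w => if S w then 1 else 0) := by
  unfold prob EE
  congr 1; ext w
  by_cases hw : IsExitPath N x w <;> by_cases hS : S w <;> simp [exW, hw, hS]

/-- product of the site weights along the path -/
def pathW (s : ℤ → ℝ) : ℤ → List Bool → ℝ
  | x, [] => s x
  | x, b :: w => s x * pathW s (nxt x b) w

lemma pathW_abs (s : ℤ → ℝ) (hs : ∀ z, |s z| ≤ 1) (x : ℤ) (w : List Bool) :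
    |pathW s x w| ≤ 1 := by
  induction w generalizing x with
  | nil => exact hs x
  | cons b w ih =>
    rw [pathW, abs_mul]
    exact mul_le_one₀ (hs x) (abs_nonneg _) (ih _)

lemma pathW_mul (s t : ℤ → ℝ) (x : ℤ) (w : List Bool) :
    pathW (fun z => s z * t z) x w = pathW s x w * pathW t x w := by
  induction w generalizing x with
  | nil => rfl
  | cons b w ih => rw [pathW, pathW, pathW, ih]; ring

lemma localTime_nil (x y : ℤ) : localTime x y [] = if x = y then 1 else 0 := by
  unfold localTime
  rw [Finset.card_filter]
  simp [walkPos_nil]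

lemma localTime_cons (x y : ℤ) (b : Bool) (w : List Bool) :
    localTime x y (b :: w) = (if x = y then 1 else 0) + localTime (nxt x b) y w := by
  unfold localTime
  rw [Finset.card_filter, Finset.card_filter, List.length_cons, Finset.sum_range_succ', add_comm]
  simp [walkPos_nil, walkPos_cons]

/-- mark the site `y` by `t` -/
def mrk (y : ℤ) (t : ℝ) (z : ℤ) : ℝ := if z = y then t else 1

lemma pathW_mrk (y : ℤ) (t : ℝ) (x : ℤ) (w : List Bool) :
    pathW (mrk y t) x w = t ^ localTime x y w := by
  induction w generalizing x with
  | nil => rw [pathW, localTime_nil, mrk]; split_ifs <;> simp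
  | cons b w ih => rw [pathW, localTime_cons, mrk, ih, pow_add]; split_ifs <;> simp

/-- expectation of product weight -/
noncomputable def UU (N : ℕ) (p : ℝ) (s : ℤ → ℝ) (x : ℤ) : ℝ := EE N p x (pathW s x)

lemma tsum_list (f : List Bool → ℝ) (hf : Summable f) :
    ∑' w, f w = f [] + (∑' w, f (true :: w) + ∑' w, f (false :: w)) := by
  let e : Unit ⊕ (List Bool ⊕ List Bool) ≃ List Bool :=
    { toFun := Sum.elim (fun _ => []) (Sum.elim (List.cons true) (List.cons false))
      invFun := fun w => match w with
        | [] => Sum.inl ()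
        | true :: w => Sum.inr (Sum.inl w)
        | false :: w => Sum.inr (Sum.inr w)
      left_inv := by rintro (_ | _ | _) <;> rfl
      right_inv := by rintro (_ | ⟨_ | _, _⟩) <;> rfl }
  have h := e.summable_iff.2 hf
  rw [← e.tsum_eq]
  change ∑' c, (f ∘ e) c = _
  have h2 := h.comp_injective (i := Sum.inr) Sum.inr_injective
  rw [Summable.tsum_sum (h.comp_injective Sum.inl_injective) h2]
  change _ + ∑' c, ((f ∘ e) ∘ Sum.inr) c = _
  rw [Summable.tsum_sum (h2.comp_injective Sum.inl_injective) (h2.comp_injective Sum.inr_injective)]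
  simp [e, Function.comp_def]

lemma UU_step (N : ℕ) (p : ℝ) (h0 : 0 ≤ p) (h1 : p ≤ 1) (s : ℤ → ℝ) (hs : ∀ z, |s z| ≤ 1)
    (x : ℤ) (hx : 0 < x ∧ x < N) :
    UU N p s x = s x * (p * UU N p s (x + 1) + (1 - p) * UU N p s (x - 1)) := by
  unfold UU EE
  rw [tsum_list _ (summable_EE N p h0 h1 x _ ⟨1, pathW_abs s hs x⟩)]
  simp only [exW_true N p x hx, exW_false N p x hx, exW_nil_in N p x hx]
  rw [← tsum_mul_left, ← tsum_mul_left, mul_add, ← tsum_mul_left, ← tsum_mul_left]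
  simp only [pathW, nxt]
  rw [zero_mul, zero_add]
  congr 1 <;> (congr 1; ext w; simp; ring)

lemma UU_bd (N : ℕ) (p : ℝ) (h0 : 0 ≤ p) (h1 : p ≤ 1) (s : ℤ → ℝ) (hs : ∀ z, |s z| ≤ 1)
    (x : ℤ) (hx : x = 0 ∨ x = N) : UU N p s x = s x := by
  unfold UU EE
  rw [tsum_list _ (summable_EE N p h0 h1 x _ ⟨1, pathW_abs s hs x⟩)]
  have hx' : ¬ (0 < x ∧ x < N) := by omega
  simp [exW_cons_out N p x hx', exW_nil_bd N p x hx, pathW]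

lemma UU_abs (N : ℕ) (p : ℝ) (h0 : 0 ≤ p) (h1 : p ≤ 1) (s : ℤ → ℝ) (hs : ∀ z, |s z| ≤ 1)
    (x : ℤ) : |UU N p s x| ≤ 1 := EE_abs_le N p h0 h1 x _ (pathW_abs s hs x)

lemma max_principle (N : ℕ) (p : ℝ) (h0 : 0 < p) (h1 : p < 1) (g : ℤ → ℝ) (M : ℝ)
    (g0 : g 0 ≤ M) (gN : g N ≤ M)
    (H : ∀ x : ℤ, 0 < x → x < N → g x ≤ M ∨ g x ≤ p * g (x + 1) + (1 - p) * g (x - 1))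
    (x : ℤ) (hx0 : 0 ≤ x) (hxN : x ≤ N) : g x ≤ M := by
  by_contra hcon
  push Not at hcon
  have hne : (Finset.Icc (0 : ℤ) N).Nonempty := ⟨x, by simp [hx0, hxN]⟩
  obtain ⟨z, hz, hmax⟩ := Finset.exists_max_image _ g hne
  have hKM : M < g z := lt_of_lt_of_le hcon (hmax x (by simp [hx0, hxN]))
  have hne2 : ((Finset.Icc (0 : ℤ) N).filter fun t => g t = g z).Nonempty :=
    ⟨z, Finset.mem_filter.2 ⟨hz, rfl⟩⟩
  obtain ⟨y, hy, hmin⟩ := Finset.exists_min_image _ (fun t : ℤ => t) hne2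
  simp only [Finset.mem_filter, Finset.mem_Icc] at hy hmin hmax
  obtain ⟨⟨hy0, hyN⟩, hyz⟩ := hy
  have hy0' : y ≠ 0 := by rintro rfl; linarith
  have hyN' : y ≠ N := by rintro rfl; linarith
  have hy1 : 0 < y := by omega
  have hy2 : y < N := by omega
  rcases H y hy1 hy2 with h | h
  · linarith
  · have e1 : g (y + 1) ≤ g z := hmax _ ⟨by omega, by omega⟩
    have e2 : g (y - 1) ≤ g z := hmax _ ⟨by omega, by omega⟩
    have e3 : g (y - 1) ≠ g z := by
      intro h'
      have := hmin (y - 1) ⟨⟨by omega, by omega⟩, h'⟩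
      omega
    have e4 : g (y - 1) < g z := lt_of_le_of_ne e2 e3
    have a1 := mul_le_mul_of_nonneg_left e1 h0.le
    have a2 := mul_lt_mul_of_pos_left e4 (sub_pos.2 h1)
    nlinarith

/-- harmonicity on the open interval `(m, m+n)` -/
def Harm (p : ℝ) (h : ℤ → ℝ) (m : ℤ) (n : ℕ) : Prop :=
  ∀ z : ℤ, m < z → z < m + n → h z = p * h (z + 1) + (1 - p) * h (z - 1)

lemma harm_inc (p : ℝ) (h0 : 0 < p) (h : ℤ → ℝ) (m : ℤ) (n : ℕ) (H : Harm p h m n)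
    (j : ℕ) (hj : j < n) :
    h (m + j + 1) - h (m + j) = ((1 - p) / p) ^ j * (h (m + 1) - h m) := by
  induction j with
  | zero => simp
  | succ j ih =>
    have ih := ih (by omega)
    have e := H (m + j + 1) (by omega) (by omega)
    rw [show m + (j : ℤ) + 1 - 1 = m + j by ring] at e
    rw [pow_succ, mul_right_comm, ← ih]
    push_cast
    rw [show m + ((j : ℤ) + 1) = m + j + 1 by ring]
    field_simp
    linarith

lemma harm_val (p : ℝ) (h0 : 0 < p) (h : ℤ → ℝ) (m : ℤ) (n : ℕ) (H : Harm p h m n)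
    (j : ℕ) (hj : j ≤ n) :
    h (m + j) = h m + (h (m + 1) - h m) * ∑ i ∈ Finset.range j, ((1 - p) / p) ^ i := by
  induction j with
  | zero => simp
  | succ j ih =>
    have ih := ih (by omega)
    have e := harm_inc p h0 h m n H j (by omega)
    rw [Finset.sum_range_succ]
    push_cast
    rw [← add_assoc]
    linarith

lemma sig_bd (ρ κ : ℝ) (N : ℕ) (r0 : 0 < ρ) (r1 : ρ ≤ 1) (hκ : κ ≤ ρ ^ N) (j l : ℕ)
    (hjl : j ≤ l) (hl : l ≤ N) :
    ((l : ℝ) - j) * κ ≤ ∑ i ∈ Finset.range l, ρ ^ i - ∑ i ∈ Finset.range j, ρ ^ i ∧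
    ∑ i ∈ Finset.range l, ρ ^ i - ∑ i ∈ Finset.range j, ρ ^ i ≤ (l : ℝ) - j := by
  rw [← Finset.sum_Ico_eq_sub _ hjl]
  constructor
  · have := Finset.card_nsmul_le_sum (Finset.Ico j l) (fun i => ρ ^ i) κ (by
      intro i hi
      simp only [Finset.mem_Ico] at hi
      exact hκ.trans (pow_le_pow_of_le_one r0.le r1 (by omega)))
    rw [Nat.card_Ico, nsmul_eq_mul, Nat.cast_sub hjl] at this
    exact this
  · have := Finset.sum_le_card_nsmul (Finset.Ico j l) (fun i => ρ ^ i) 1 (by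
      intro i hi
      exact pow_le_one₀ r0.le r1)
    rw [Nat.card_Ico, nsmul_eq_mul, Nat.cast_sub hjl, mul_one] at this
    exact this

lemma rho_bd (p : ℝ) (h0 : 1 / 2 ≤ p) (h1 : p < 1) : 0 < (1 - p) / p ∧ (1 - p) / p ≤ 1 := by
  have : 0 < p := by linarith
  refine ⟨div_pos (by linarith) this, ?_⟩
  rw [div_le_one this]; linarith

lemma harm_lower (p : ℝ) (h0 : 1 / 2 ≤ p) (h1 : p < 1) (N : ℕ) (κ : ℝ) (κ0 : 0 < κ)
    (hκ : κ ≤ ((1 - p) / p) ^ N) (h : ℤ → ℝ) (m : ℤ) (n : ℕ) (H : Harm p h m n)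
    (hn : 0 < n) (hnN : n ≤ N) (hm : 0 ≤ h m) (hmn : 0 ≤ h (m + n)) (j : ℕ) (hj : j ≤ n) :
    κ * (h m * ((n : ℝ) - j) + h (m + n) * j) ≤ n * h (m + j) := by
  obtain ⟨r0, r1⟩ := rho_bd p h0 h1
  have e1 := harm_val p (by linarith) h m n H j hj
  have e2 := harm_val p (by linarith) h m n H n le_rfl
  have s1 := sig_bd _ κ N r0 r1 hκ j n hj hnN
  have s2 := sig_bd _ κ N r0 r1 hκ 0 j (by omega) (by omega)
  have s3 := sig_bd _ κ N r0 r1 hκ 0 n (by omega) (by omega)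
  simp only [Finset.range_zero, Finset.sum_empty, sub_zero, Nat.cast_zero] at s2 s3
  set σj := ∑ i ∈ Finset.range j, ((1 - p) / p) ^ i
  set σn := ∑ i ∈ Finset.range n, ((1 - p) / p) ^ i
  set d := h (m + 1) - h m
  have hn' : (0 : ℝ) < n := by exact_mod_cast hn
  have hj' : (j : ℝ) ≤ n := by exact_mod_cast hj
  have key : σn * h (m + j) = h m * (σn - σj) + h (m + n) * σj := by
    rw [e1, e2]; ring
  have low : κ * (h m * ((n : ℝ) - j) + h (m + n) * j) ≤ σn * h (m + j) := by
    rw [key]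
    have := mul_le_mul_of_nonneg_left s1.1 hm
    have := mul_le_mul_of_nonneg_left s2.1 hmn
    linarith
  have σpos : 0 < σn := lt_of_lt_of_le (by positivity) s3.1
  have hnn : 0 ≤ h (m + j) := by
    have : 0 ≤ κ * (h m * ((n : ℝ) - j) + h (m + n) * j) := by
      have : (0 : ℝ) ≤ n - j := by linarith
      positivity
    exact nonneg_of_mul_nonneg_right (this.trans low) σpos
  exact low.trans (mul_le_mul_of_nonneg_right s3.2 hnn)

lemma harm_grad (p : ℝ) (h0 : 1 / 2 ≤ p) (h1 : p < 1) (N : ℕ) (κ : ℝ) (κ0 : 0 < κ)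
    (hκ : κ ≤ ((1 - p) / p) ^ N) (h : ℤ → ℝ) (m : ℤ) (n : ℕ) (H : Harm p h m n)
    (hn : 0 < n) (hnN : n ≤ N) (hm : |h m| ≤ 1) (hmn : |h (m + n)| ≤ 1) :
    |h (m + 1) - h m| ≤ 2 / (n * κ) ∧ |h (m + n) - h (m + n - 1)| ≤ 2 / (n * κ) := by
  obtain ⟨r0, r1⟩ := rho_bd p h0 h1
  have e2 := harm_val p (by linarith) h m n H n le_rfl
  have s3 := sig_bd _ κ N r0 r1 hκ 0 n (by omega) (by omega)
  simp only [Finset.range_zero, Finset.sum_empty, sub_zero, Nat.cast_zero] at s3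
  have e3 := harm_inc p (by linarith) h m n H (n - 1) (by omega)
  set σn := ∑ i ∈ Finset.range n, ((1 - p) / p) ^ i
  have hn' : (0 : ℝ) < n := by exact_mod_cast hn
  have A : |h (m + 1) - h m| ≤ 2 / (n * κ) := by
    rw [le_div_iff₀ (by positivity)]
    calc |h (m + 1) - h m| * (n * κ) ≤ |h (m + 1) - h m| * σn :=
          mul_le_mul_of_nonneg_left s3.1 (abs_nonneg _)
      _ = |h (m + n) - h m| := by
          rw [e2, add_sub_cancel_left, abs_mul, abs_of_pos (lt_of_lt_of_le (by positivity) s3.1)]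
      _ ≤ |h (m + n)| + |h m| := abs_sub _ _
      _ ≤ 2 := by linarith
  refine ⟨A, ?_⟩
  have c : ((n - 1 : ℕ) : ℤ) = n - 1 := by omega
  rw [c, show m + ((n : ℤ) - 1) + 1 = m + n by ring, ← add_sub_assoc] at e3
  rw [e3, abs_mul, abs_of_pos (pow_pos r0 _)]
  exact (mul_le_of_le_one_left (abs_nonneg _) (pow_le_one₀ r0.le r1)).trans A

lemma key_bound (N : ℕ) (p : ℝ) (h0 : 1 / 2 ≤ p) (h1 : p < 1) (κ : ℝ) (κ0 : 0 < κ)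
    (hκ : κ ≤ ((1 - p) / p) ^ N) (y : ℤ) (L : ℕ) (hL : 0 < L) (hy0 : L ≤ y) (hyN : y + L ≤ N)
    (s : ℤ → ℝ) (hs : ∀ z, |s z| ≤ 1) (hs1 : ∀ z, |z - y| < L → s z = 1)
    (x : ℤ) (hx0 : 0 ≤ x) (hxN : x ≤ N) :
    |UU N p (fun z => s z * mrk y (-1) z) x - UU N p (fun z => s z * mrk y 0 z) x| ≤
      2 / (L * κ) := by
  have p0 : 0 ≤ p := by linarith
  have hsm : ∀ t : ℝ, |t| ≤ 1 → ∀ z, |s z * mrk y t z| ≤ 1 := by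
    intro t ht z
    rw [abs_mul]
    refine mul_le_one₀ (hs z) (abs_nonneg _) ?_
    unfold mrk; split_ifs <;> simp [ht]
  have b1 := hsm (-1) (by simp)
  have b0 := hsm 0 (by simp)
  set u := UU N p (fun z => s z * mrk y (-1) z) with hu
  set v := UU N p (fun z => s z * mrk y 0 z) with hv
  have su := UU_step N p p0 h1.le _ b1
  have sv := UU_step N p p0 h1.le _ b0
  rw [← hu] at su
  rw [← hv] at sv
  have bu := UU_abs N p p0 h1.le _ b1
  rw [← hu] at bu
  have HR : Harm p u y L := by
    intro z hz1 hz2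
    have e := su z ⟨by omega, by omega⟩
    rw [hs1 z (by rw [abs_lt]; omega), mrk, if_neg (by omega)] at e
    linarith
  have HL : Harm p u (y - L) L := by
    intro z hz1 hz2
    have e := su z ⟨by omega, by omega⟩
    rw [hs1 z (by rw [abs_lt]; omega), mrk, if_neg (by omega)] at e
    linarith
  have gR := (harm_grad p h0 h1 N κ κ0 hκ u y L HR hL (by omega) (bu _) (bu _)).1
  have gL := (harm_grad p h0 h1 N κ κ0 hκ u (y - L) L HL hL (by omega) (bu _) (bu _)).2
  rw [sub_add_cancel] at gL
  set ε := 2 / (L * κ)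
  have hL' : (0 : ℝ) < L := by exact_mod_cast hL
  have ε0 : 0 ≤ ε := by positivity
  have uy : |u y| ≤ ε := by
    have e := su y ⟨by omega, by omega⟩
    rw [hs1 y (by simp [hL]), mrk, if_pos rfl] at e
    rw [abs_le] at gR gL ⊢
    constructor <;> nlinarith
  have vy : v y = 0 := by
    have e := sv y ⟨by omega, by omega⟩
    rw [e, mrk, if_pos rfl]; ring
  have bdry : ∀ z : ℤ, z = 0 ∨ z = N → u z - v z = 0 := by
    intro z hz
    rw [hu, hv, UU_bd N p p0 h1.le _ b1 z hz, UU_bd N p p0 h1.le _ b0 z hz, mrk, mrk,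
      if_neg (by omega), if_neg (by omega), sub_self]
  refine max_principle N p (by linarith) h1 (fun z => |u z - v z|) ε ?_ ?_ ?_ x hx0 hxN
  · simp [bdry 0 (Or.inl rfl), ε0]
  · simp [bdry N (Or.inr rfl), ε0]
  · intro z hz0 hzN
    by_cases hzy : z = y
    · left; simp only [hzy, vy, sub_zero, uy]
    · right
      have e1 := su z ⟨hz0, hzN⟩
      have e2 := sv z ⟨hz0, hzN⟩
      rw [mrk, if_neg hzy, mul_one] at e1 e2
      have : u z - v z = s z * (p * (u (z + 1) - v (z + 1)) + (1 - p) * (u (z - 1) - v (z - 1))) := by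
        rw [e1, e2]; ring
      simp only [this, abs_mul]
      refine (mul_le_of_le_one_left (abs_nonneg _) (hs z)).trans ?_
      refine (abs_add_le _ _).trans ?_
      rw [abs_mul, abs_mul, abs_of_nonneg p0, abs_of_nonneg (sub_nonneg.2 h1.le)]

lemma lower_bound (N : ℕ) (p : ℝ) (h0 : 1 / 2 ≤ p) (h1 : p < 1) (κ : ℝ) (κ0 : 0 < κ)
    (hκ : κ ≤ ((1 - p) / p) ^ N) (y : ℤ) (L : ℕ) (hL : 0 < L) (hy0 : L ≤ y) (hyN : y + L ≤ N)
    (x : ℤ) (hx0 : L ≤ x) (hxN : x + L ≤ N) :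
    κ ^ 2 * ((L : ℝ) / N) ^ 2 ≤
      UU N p (mrk 0 0) x - UU N p (fun z => mrk 0 0 z * mrk y 0 z) x := by
  have p0 : 0 ≤ p := by linarith
  have a1 : ∀ z, |mrk 0 0 z| ≤ 1 := by intro z; unfold mrk; split_ifs <;> simp
  have a2 : ∀ z, |mrk 0 0 z * mrk y 0 z| ≤ 1 := by intro z; unfold mrk; split_ifs <;> simp
  set u := UU N p (mrk 0 0) with hu
  set v := UU N p (fun z => mrk 0 0 z * mrk y 0 z) with hv
  have su := UU_step N p p0 h1.le _ a1
  have sv := UU_step N p p0 h1.le _ a2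
  rw [← hu] at su
  rw [← hv] at sv
  have Hu : Harm p u 0 N := by
    intro z hz1 hz2
    have e := su z ⟨by omega, by omega⟩
    rw [mrk, if_neg (by omega)] at e
    linarith
  have u0 : u 0 = 0 := by rw [hu, UU_bd N p p0 h1.le _ a1 0 (Or.inl rfl)]; simp [mrk]
  have uN : u N = 1 := by
    rw [hu, UU_bd N p p0 h1.le _ a1 N (Or.inr rfl)]; unfold mrk; rw [if_neg (by omega)]
  have v0 : v 0 = 0 := by rw [hv, UU_bd N p p0 h1.le _ a2 0 (Or.inl rfl)]; simp [mrk]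
  have vN : v N = 1 := by
    rw [hv, UU_bd N p p0 h1.le _ a2 N (Or.inr rfl)]; unfold mrk
    rw [if_neg (by omega), if_neg (by omega)]; ring
  have vy : v y = 0 := by
    rw [sv y ⟨by omega, by omega⟩]; simp [mrk]
  have hN : 0 < N := by omega
  have hN' : (0 : ℝ) < N := by exact_mod_cast hN
  have hL' : (0 : ℝ) < L := by exact_mod_cast hL
  have lu := harm_lower p h0 h1 N κ κ0 hκ u 0 N Hu hN le_rfl (by rw [u0])
    (by rw [zero_add, uN]; norm_num) y.toNat (by omega)
  rw [Int.toNat_of_nonneg (by omega), zero_add, zero_add, u0, uN] at lu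
  have yL : (L : ℝ) ≤ (y.toNat : ℝ) := by exact_mod_cast (by omega : L ≤ y.toNat)
  have uy : κ * ((L : ℝ) / N) ≤ u y := by
    rw [mul_div_assoc', div_le_iff₀ hN']
    nlinarith
  have uy0 : 0 ≤ u y := le_trans (by positivity) uy
  set D : ℤ → ℝ := fun z => u z - v z with hD
  have HD : ∀ z : ℤ, 0 < z → z < N → z ≠ y → D z = p * D (z + 1) + (1 - p) * D (z - 1) := by
    intro z hz1 hz2 hzy
    have e1 := su z ⟨hz1, hz2⟩
    have e2 := sv z ⟨hz1, hz2⟩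
    simp only [mrk, if_neg hzy, if_neg hz1.ne'] at e1 e2
    simp only [hD]
    linarith
  have Dy : D y = u y := by simp [hD, vy]
  have D0 : D 0 = 0 := by simp [hD, u0, v0]
  have DN : D N = 0 := by simp [hD, uN, vN]
  suffices κ * ((L : ℝ) / N) * u y ≤ D x by
    refine le_trans ?_ this
    calc κ ^ 2 * ((L : ℝ) / N) ^ 2 = κ * ((L : ℝ) / N) * (κ * ((L : ℝ) / N)) := by ring
      _ ≤ _ := mul_le_mul_of_nonneg_left uy (by positivity)
  suffices ∃ n : ℕ, n ≤ N ∧ 0 < n ∧ κ * (u y * L) ≤ n * D x by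
    obtain ⟨n, hn, hn0, hh⟩ := this
    have hn' : (n : ℝ) ≤ N := by exact_mod_cast hn
    have hn0' : (0 : ℝ) < n := by exact_mod_cast hn0
    have : 0 ≤ D x := by
      have : 0 ≤ (n : ℝ) * D x := le_trans (by positivity) hh
      exact nonneg_of_mul_nonneg_right this hn0'
    rw [mul_div_assoc', div_mul_eq_mul_div, div_le_iff₀ hN']
    nlinarith
  rcases le_total x y with hxy | hxy
  · refine ⟨y.toNat, by omega, by omega, ?_⟩
    have cy : ((y.toNat : ℕ) : ℤ) = y := Int.toNat_of_nonneg (by omega)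
    have cx : ((x.toNat : ℕ) : ℤ) = x := Int.toNat_of_nonneg (by omega)
    have := harm_lower p h0 h1 N κ κ0 hκ D 0 y.toNat
      (fun z a b => HD z a (by omega) (by omega)) (by omega) (by omega) (by rw [D0])
      (by rw [zero_add, cy, Dy]; exact uy0) x.toNat (by omega)
    rw [zero_add, zero_add, cy, cx, D0, Dy] at this
    refine le_trans ?_ this
    have xL : (L : ℝ) ≤ (x.toNat : ℝ) := by exact_mod_cast (by omega : L ≤ x.toNat)
    rw [zero_mul, zero_add]
    gcongr
  · refine ⟨(N - y).toNat, by omega, by omega, ?_⟩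
    have cy : (((N - y).toNat : ℕ) : ℤ) = N - y := Int.toNat_of_nonneg (by omega)
    have cx : (((x - y).toNat : ℕ) : ℤ) = x - y := Int.toNat_of_nonneg (by omega)
    have := harm_lower p h0 h1 N κ κ0 hκ D y (N - y).toNat
      (fun z a b => HD z (by omega) (by omega) (by omega)) (by omega) (by omega)
      (by rw [Dy]; exact uy0)
      (by rw [cy, add_sub_cancel, DN]) (x - y).toNat (by omega)
    rw [cy, cx, add_sub_cancel, add_sub_cancel, DN, Dy] at this
    refine le_trans ?_ this
    have xL : (L : ℝ) ≤ ((N - y).toNat : ℝ) - ((x - y).toNat : ℝ) := by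
      rw [le_sub_iff_add_le]
      exact_mod_cast (by omega : L + (x - y).toNat ≤ (N - y).toNat)
    rw [zero_mul, add_zero]
    gcongr

lemma reach_up (N : ℕ) (x y : ℤ) (w : List Bool) (hend : walkPos x w = N)
    (hxy : x ≤ y) (hyN : y ≤ N) : 1 ≤ localTime x y w := by
  induction w generalizing x with
  | nil =>
    rw [walkPos_nil] at hend
    rw [localTime_nil, if_pos (by omega)]
  | cons b w ih =>
    rw [walkPos_cons] at hend
    rw [localTime_cons]
    by_cases h : x = y
    · rw [if_pos h]; omega
    · have := ih (nxt x b) hend (by unfold nxt; split_ifs <;> omega)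
      omega

lemma reach_up2 (N : ℕ) (x y y' : ℤ) (w : List Bool) (hend : walkPos x w = N)
    (hv : 1 ≤ localTime x y w) (hyy : y ≤ y') (hyN : y' ≤ N) : 1 ≤ localTime x y' w := by
  induction w generalizing x with
  | nil =>
    refine reach_up N x y' [] hend ?_ hyN
    rw [localTime_nil] at hv
    split_ifs at hv with h <;> omega
  | cons b w ih =>
    by_cases h : x = y
    · exact reach_up N x y' _ hend (by omega) hyN
    · rw [localTime_cons, if_neg h, zero_add] at hv
      rw [walkPos_cons] at hend
      rw [localTime_cons]
      have := ih _ hend hv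
      omega

lemma localTime_zero_end (x : ℤ) (w : List Bool) (h : walkPos x w = 0) : 1 ≤ localTime x 0 w := by
  induction w generalizing x with
  | nil =>
    rw [walkPos_nil] at h
    rw [localTime_nil, if_pos h]
  | cons b w ih =>
    rw [walkPos_cons] at h
    rw [localTime_cons]
    have := ih _ h
    omega

lemma hits_iff (N : ℕ) (x y : ℤ) (w : List Bool) (hw : IsExitPath N x w) (hxy : x ≠ y)
    (hy0 : y ≠ 0) (hyN : y ≠ N) : hitsBefore x y w ↔ 1 ≤ localTime x y w := by
  unfold hitsBefore localTime
  rw [Nat.succ_le_iff, Finset.card_pos]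
  constructor
  · rintro ⟨k, h1, h2, h3⟩
    exact ⟨k, by simp only [Finset.mem_filter, Finset.mem_range]; exact ⟨by omega, h3⟩⟩
  · rintro ⟨k, hk⟩
    simp only [Finset.mem_filter, Finset.mem_range] at hk
    obtain ⟨h1, h2⟩ := hk
    refine ⟨k, ?_, ?_, h2⟩
    · rcases Nat.eq_zero_or_pos k with rfl | h
      · rw [List.take_zero, walkPos_nil] at h2; exact absurd h2 hxy
      · exact h
    · rcases Nat.lt_or_ge k w.length with h | h
      · exact h
      · rw [List.take_of_length_le h] at h2
        have := hw.2
        omega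

/-- functions in the span of `1`, `(-1)^n`, `0^n` with small coefficients -/
def Nice (f : ℕ → ℝ) : Prop :=
  ∃ a b c : ℝ, |a| ≤ 1 ∧ |b| ≤ 1 ∧ |c| ≤ 1 ∧ ∀ n, f n = a + (b * (-1) ^ n + c * 0 ^ n)

lemma Bd.mul {F G : List Bool → ℝ} (hF : Bd F) (hG : Bd G) : Bd (fun w => F w * G w) := by
  obtain ⟨A, hA⟩ := hF
  obtain ⟨B, hB⟩ := hG
  refine ⟨A * B, fun w => ?_⟩
  rw [abs_mul]
  exact mul_le_mul (hA w) (hB w) (abs_nonneg _) ((abs_nonneg _).trans (hA w))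

lemma Bd.add {F G : List Bool → ℝ} (hF : Bd F) (hG : Bd G) : Bd (fun w => F w + G w) := by
  obtain ⟨A, hA⟩ := hF
  obtain ⟨B, hB⟩ := hG
  exact ⟨A + B, fun w => (abs_add_le _ _).trans (add_le_add (hA w) (hB w))⟩

lemma Bd.sub {F G : List Bool → ℝ} (hF : Bd F) (hG : Bd G) : Bd (fun w => F w - G w) := by
  obtain ⟨A, hA⟩ := hF
  obtain ⟨B, hB⟩ := hG
  exact ⟨A + B, fun w => (abs_sub _ _).trans (add_le_add (hA w) (hB w))⟩

lemma Bd_const (c : ℝ) : Bd (fun _ => c) := ⟨|c|, fun _ => le_rfl⟩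

lemma Bd_pow (t : ℝ) (ht : |t| ≤ 1) (g : List Bool → ℕ) : Bd (fun w => t ^ g w) :=
  ⟨1, fun w => by rw [abs_pow]; exact pow_le_one₀ (abs_nonneg _) ht⟩

lemma Bd_nice (f : ℕ → ℝ) (hf : Nice f) (g : List Bool → ℕ) : Bd (fun w => f (g w)) := by
  obtain ⟨a, b, c, _, _, _, h⟩ := hf
  simp only [h]
  exact (Bd_const a).add (((Bd_const b).mul (Bd_pow _ (by simp) g)).add
    ((Bd_const c).mul (Bd_pow _ (by simp) g)))

lemma Bd_prod {ι : Type*} [DecidableEq ι] (J : Finset ι) (F : ι → List Bool → ℝ)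
    (hF : ∀ i, Bd (F i)) : Bd (fun w => ∏ i ∈ J, F i w) := by
  induction J using Finset.induction_on with
  | empty => simpa using Bd_const 1
  | insert i J hi ih =>
    simp only [Finset.prod_insert hi]
    exact (hF i).mul ih

lemma mrk_abs (y : ℤ) (t : ℝ) (ht : |t| ≤ 1) (s : ℤ → ℝ) (hs : ∀ z, |s z| ≤ 1) (z : ℤ) :
    |s z * mrk y t z| ≤ 1 := by
  rw [abs_mul]
  refine mul_le_one₀ (hs z) (abs_nonneg _) ?_
  unfold mrk; split_ifs <;> simp [ht]

lemma claimA (N : ℕ) (p : ℝ) (h0 : 1 / 2 ≤ p) (h1 : p < 1) (κ : ℝ) (κ0 : 0 < κ)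
    (hκ : κ ≤ ((1 - p) / p) ^ N) (k : ℕ) (y : Fin k → ℤ) (L : ℕ) (hL : 0 < L)
    (hy0 : ∀ i, L ≤ y i) (hyN : ∀ i, y i + L ≤ N) (hgap : ∀ i j, i ≠ j → L ≤ |y i - y j|)
    (x : ℤ) (hx0 : 0 ≤ x) (hxN : x ≤ N) (i0 : Fin k) (f : Fin k → ℕ → ℝ) (hf : ∀ i, Nice (f i))
    (J : Finset (Fin k)) (hJ : i0 ∉ J)
    (s : ℤ → ℝ) (hs : ∀ z, |s z| ≤ 1) (hs1 : ∀ z, |z - y i0| < L → s z = 1) :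
    |EE N p x (fun w => pathW s x w *
        (((-1) ^ localTime x (y i0) w - 0 ^ localTime x (y i0) w) *
          ∏ j ∈ J, f j (localTime x (y j) w)))| ≤ 3 ^ J.card * (2 / (L * κ)) := by
  have p0 : 0 ≤ p := by linarith
  induction J using Finset.induction_on generalizing s with
  | empty =>
    have e : (fun w => pathW s x w *
        (((-1) ^ localTime x (y i0) w - 0 ^ localTime x (y i0) w) *
          ∏ j ∈ (∅ : Finset (Fin k)), f j (localTime x (y j) w))) =
        fun w => pathW (fun z => s z * mrk (y i0) (-1) z) x w -
          pathW (fun z => s z * mrk (y i0) 0 z) x w := by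
      ext w
      rw [pathW_mul, pathW_mul, pathW_mrk, pathW_mrk, Finset.prod_empty]; ring
    rw [e, EE_sub N p p0 h1.le x _ _ ⟨1, pathW_abs _ (mrk_abs _ _ (by simp) s hs) x⟩
      ⟨1, pathW_abs _ (mrk_abs _ _ (by simp) s hs) x⟩, Finset.card_empty, pow_zero, one_mul]
    exact key_bound N p h0 h1 κ κ0 hκ (y i0) L hL (hy0 _) (hyN _) s hs hs1 x hx0 hxN
  | insert j J hj ih =>
    have hne : i0 ≠ j := fun h => hJ (by simp [h])
    have hJ' : i0 ∉ J := fun h => hJ (by simp [h])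
    obtain ⟨a, b, c, ha, hb, hc, hfj⟩ := hf j
    set R : List Bool → ℝ := fun w =>
      (((-1) ^ localTime x (y i0) w - 0 ^ localTime x (y i0) w) *
          ∏ j ∈ J, f j (localTime x (y j) w)) with hR
    have bR : Bd R := ((Bd_pow _ (by simp) _).sub (Bd_pow _ (by simp) _)).mul
      (Bd_prod J _ fun i => Bd_nice _ (hf i) _)
    have near : ∀ t : ℝ, ∀ z, |z - y i0| < L → s z * mrk (y j) t z = 1 := by
      intro t z hz
      have : z ≠ y j := by
        rintro rfl
        have := hgap j i0 hne.symm
        omega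
      rw [hs1 z hz, mrk, if_neg this, one_mul]
    have b1 : ∀ t : ℝ, |t| ≤ 1 → Bd (fun w => pathW (fun z => s z * mrk (y j) t z) x w * R w) :=
      fun t ht => Bd.mul ⟨1, pathW_abs _ (mrk_abs _ _ ht s hs) x⟩ bR
    have b2 : Bd (fun w => pathW s x w * R w) := Bd.mul ⟨1, pathW_abs _ hs x⟩ bR
    have i1 := ih hJ' s hs hs1
    have i2 := ih hJ' _ (mrk_abs (y j) (-1) (by simp) s hs) (near _)
    have i3 := ih hJ' _ (mrk_abs (y j) 0 (by simp) s hs) (near _)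
    have m1 : |(-1 : ℝ)| ≤ 1 := by simp
    have m0 : |(0 : ℝ)| ≤ 1 := by simp
    have e : (fun w => pathW s x w *
        (((-1) ^ localTime x (y i0) w - 0 ^ localTime x (y i0) w) *
          ∏ j ∈ insert j J, f j (localTime x (y j) w))) =
        fun w => a * (pathW s x w * R w) + 1 *
          (b * (pathW (fun z => s z * mrk (y j) (-1) z) x w * R w) +
          c * (pathW (fun z => s z * mrk (y j) 0 z) x w * R w)) := by
      ext w
      rw [pathW_mul, pathW_mul, pathW_mrk, pathW_mrk, Finset.prod_insert hj, hfj, hR]; ring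
    rw [e, EE_lin N p p0 h1.le x _ _ b2 (((Bd_const b).mul (b1 _ m1)).add ((Bd_const c).mul (b1 _ m0))),
      EE_lin N p p0 h1.le x _ _ (b1 _ m1) (b1 _ m0), Finset.card_insert_of_notMem hj, one_mul]
    refine (abs_add_le _ _).trans ?_
    have t1 := abs_add_le (b * EE N p x (fun w => pathW (fun z => s z * mrk (y j) (-1) z) x w * R w))
      (c * EE N p x (fun w => pathW (fun z => s z * mrk (y j) 0 z) x w * R w))
    rw [abs_mul, abs_mul] at t1
    rw [abs_mul]
    have u1 := (mul_le_of_le_one_left (abs_nonneg _) ha).trans i1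
    have u2 := (mul_le_of_le_one_left (abs_nonneg _) hb).trans i2
    have u3 := (mul_le_of_le_one_left (abs_nonneg _) hc).trans i3
    rw [pow_succ]
    linarith

lemma pathW_one (x : ℤ) (w : List Bool) : pathW (fun _ => 1) x w = 1 := by
  induction w generalizing x with
  | nil => rfl
  | cons b w ih => rw [pathW, ih, one_mul]

lemma claimB (N : ℕ) (p : ℝ) (h0 : 1 / 2 ≤ p) (h1 : p < 1) (κ : ℝ) (κ0 : 0 < κ)
    (hκ : κ ≤ ((1 - p) / p) ^ N) (k : ℕ) (y : Fin k → ℤ) (L : ℕ) (hL : 0 < L)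
    (hy0 : ∀ i, L ≤ y i) (hyN : ∀ i, y i + L ≤ N) (hgap : ∀ i j, i ≠ j → L ≤ |y i - y j|)
    (x : ℤ) (hx0 : 0 ≤ x) (hxN : x ≤ N) (f g : Fin k → ℕ → ℝ) (hf : ∀ i, Nice (f i))
    (hg : ∀ i, Nice (g i))
    (hd : ∀ i, ∃ d : ℝ, |d| ≤ 1 ∧ ∀ n, f i n - g i n = d * ((-1) ^ n - 0 ^ n))
    (J : Finset (Fin k)) :
    |EE N p x (fun w => ∏ j, (if j ∈ J then f j else g j) (localTime x (y j) w)) -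
      EE N p x (fun w => ∏ j, g j (localTime x (y j) w))| ≤
      J.card * (3 ^ k * (2 / (L * κ))) := by
  have p0 : 0 ≤ p := by linarith
  induction J using Finset.induction_on with
  | empty => simp
  | insert i J hi ih =>
    have nice : ∀ K : Finset (Fin k), ∀ j, Nice (if j ∈ K then f j else g j) := by
      intro K j; split_ifs; exacts [hf j, hg j]
    have bdd : ∀ K : Finset (Fin k), Bd (fun w => ∏ j, (if j ∈ K then f j else g j)
        (localTime x (y j) w)) := fun K => Bd_prod _ _ fun j => Bd_nice _ (nice K j) _
    obtain ⟨d, hd1, hd2⟩ := hd i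
    have A := claimA N p h0 h1 κ κ0 hκ k y L hL hy0 hyN hgap x hx0 hxN i
      (fun j => if j ∈ J then f j else g j) (nice J) (Finset.univ.erase i) (by simp)
      (fun _ => 1) (by simp) (by simp)
    set R : List Bool → ℝ := (fun w => pathW (fun _ => 1) x w *
        (((-1) ^ localTime x (y i) w - 0 ^ localTime x (y i) w) *
          ∏ j ∈ Finset.univ.erase i, (if j ∈ J then f j else g j) (localTime x (y j) w))) with hR
    have bR : Bd R := Bd.mul ⟨1, pathW_abs _ (by simp) x⟩
      (((Bd_pow _ (by simp) _).sub (Bd_pow _ (by simp) _)).mul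
      (Bd_prod _ _ fun j => Bd_nice _ (nice J j) _))
    have e : (fun w => ∏ j, (if j ∈ insert i J then f j else g j) (localTime x (y j) w)) =
        fun w => 1 * (∏ j, (if j ∈ J then f j else g j) (localTime x (y j) w)) + d * R w := by
      ext w
      rw [← Finset.mul_prod_erase _ _ (Finset.mem_univ i),
        ← Finset.mul_prod_erase (a := i) (f := fun j => (if j ∈ J then f j else g j) _) _ (Finset.mem_univ i)]
      have e2 : ∏ j ∈ Finset.univ.erase i, (if j ∈ insert i J then f j else g j) (localTime x (y j) w)
          = ∏ j ∈ Finset.univ.erase i, (if j ∈ J then f j else g j) (localTime x (y j) w) := by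
        refine Finset.prod_congr rfl fun j hj => ?_
        have : j ≠ i := (Finset.mem_erase.1 hj).1
        simp [this]
      have := hd2 (localTime x (y i) w)
      rw [e2, hR]
      simp only [pathW_one, one_mul, Finset.mem_insert, true_or, if_true, hi, if_false]
      rw [← mul_assoc d, ← this]; ring
    rw [e, EE_lin N p p0 h1.le x _ _ (bdd J) bR, one_mul, add_sub_right_comm,
      Finset.card_insert_of_notMem hi]
    refine (abs_add_le _ _).trans ?_
    rw [abs_mul]
    have u := (mul_le_of_le_one_left (abs_nonneg _) hd1).trans A
    have hL' : (0 : ℝ) < L := by exact_mod_cast hL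
    have ε0 : 0 ≤ 2 / (L * κ) := by positivity
    have c : (3 : ℝ) ^ (Finset.univ.erase i : Finset (Fin k)).card ≤ 3 ^ k := by
      refine pow_le_pow_right₀ (by norm_num) ?_
      exact (Finset.card_le_univ _).trans (by simp)
    have u2 := u.trans (mul_le_mul_of_nonneg_right c ε0)
    push_cast
    linarith

lemma nonasym (N : ℕ) (p : ℝ) (h0 : 1 / 2 ≤ p) (h1 : p < 1) (κ : ℝ) (κ0 : 0 < κ)
    (hκ : κ ≤ ((1 - p) / p) ^ N) (k : ℕ) (hk : 1 ≤ k) (y : Fin k → ℤ) (L : ℕ) (hL : 0 < L)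
    (hmono : Monotone y)
    (hy0 : ∀ i, L ≤ y i) (hyN : ∀ i, y i + L ≤ N) (hgap : ∀ i j, i ≠ j → L ≤ |y i - y j|)
    (x : ℤ) (hx0 : L ≤ x) (hxN : x + L ≤ N) (hxy : ∀ i, x ≠ y i)
    (e : Fin k → ℕ) (he : ∀ i, e i = 0 ∨ e i = 1) :
    |prob N p x (fun w => (∀ i, localTime x (y i) w % 2 = e i) ∧ ∀ i, hitsBefore x (y i) w) -
      (1 / 2 ^ k) * prob N p x (fun w => ∀ i, hitsBefore x (y i) w)| ≤
        k * (3 ^ k * (2 / (L * κ))) ∧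
    κ ^ 2 * ((L : ℝ) / N) ^ 2 ≤ prob N p x (fun w => ∀ i, hitsBefore x (y i) w) := by
  classical
  have p0 : 0 ≤ p := by linarith
  have hits : ∀ w, IsExitPath N x w → ∀ i, (hitsBefore x (y i) w ↔ 1 ≤ localTime x (y i) w) := by
    intro w hw i
    have := hy0 i
    have := hyN i
    exact hits_iff N x (y i) w hw (hxy i) (by omega) (by omega)
  constructor
  · set f : Fin k → ℕ → ℝ := fun i n => if n % 2 = e i ∧ 1 ≤ n then 1 else 0 with hfdef
    set g : Fin k → ℕ → ℝ := fun i n => if 1 ≤ n then 1 / 2 else 0 with hgdef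
    have pw : ∀ n : ℕ, n = 0 ∨ (1 ≤ n ∧ n % 2 = 0 ∧ (-1 : ℝ) ^ n = 1 ∧ (0 : ℝ) ^ n = 0) ∨
        (1 ≤ n ∧ n % 2 = 1 ∧ (-1 : ℝ) ^ n = -1 ∧ (0 : ℝ) ^ n = 0) := by
      intro n
      rcases Nat.eq_zero_or_pos n with h | h
      · exact Or.inl h
      · rcases Nat.even_or_odd n with h2 | h2
        · exact Or.inr (Or.inl ⟨h, Nat.even_iff.1 h2, h2.neg_one_pow, zero_pow h.ne'⟩)
        · exact Or.inr (Or.inr ⟨h, Nat.odd_iff.1 h2, h2.neg_one_pow, zero_pow h.ne'⟩)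
    have nf : ∀ i, Nice (f i) := by
      intro i
      rcases he i with h | h
      · refine ⟨1 / 2, 1 / 2, -1, by norm_num [abs_le], by norm_num [abs_le], by norm_num, fun n => ?_⟩
        rcases pw n with rfl | ⟨a, b, c, d⟩ | ⟨a, b, c, d⟩
        · norm_num [hfdef]
        · simp only [hfdef, a, b, c, d, h]; norm_num
        · simp only [hfdef, a, b, c, d, h]; norm_num
      · refine ⟨1 / 2, -1 / 2, 0, by norm_num [abs_le], by norm_num [abs_le], by norm_num, fun n => ?_⟩
        rcases pw n with rfl | ⟨a, b, c, d⟩ | ⟨a, b, c, d⟩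
        · norm_num [hfdef]
        · simp only [hfdef, a, b, c, d, h]; norm_num
        · simp only [hfdef, a, b, c, d, h]; norm_num
    have ng : ∀ i, Nice (g i) := by
      intro i
      refine ⟨1 / 2, 0, -1 / 2, by norm_num [abs_le], by norm_num [abs_le], by norm_num [abs_le],
        fun n => ?_⟩
      rcases pw n with rfl | ⟨a, b, c, d⟩ | ⟨a, b, c, d⟩
      · norm_num [hgdef]
      · simp only [hgdef, a, c, d]; norm_num
      · simp only [hgdef, a, c, d]; norm_num
    have hd : ∀ i, ∃ d : ℝ, |d| ≤ 1 ∧ ∀ n, f i n - g i n = d * ((-1) ^ n - 0 ^ n) := by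
      intro i
      rcases he i with h | h
      · refine ⟨1 / 2, by norm_num [abs_le], fun n => ?_⟩
        rcases pw n with rfl | ⟨a, b, c, d⟩ | ⟨a, b, c, d⟩
        · norm_num [hfdef, hgdef]
        · simp only [hfdef, hgdef, a, b, c, d, h]; norm_num
        · simp only [hfdef, hgdef, a, b, c, d, h]; norm_num
      · refine ⟨-1 / 2, by norm_num [abs_le], fun n => ?_⟩
        rcases pw n with rfl | ⟨a, b, c, d⟩ | ⟨a, b, c, d⟩
        · norm_num [hfdef, hgdef]
        · simp only [hfdef, hgdef, a, b, c, d, h]; norm_num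
        · simp only [hfdef, hgdef, a, b, c, d, h]; norm_num
    have B := claimB N p h0 h1 κ κ0 hκ k y L hL hy0 hyN hgap x (by omega) (by omega) f g nf ng hd
      Finset.univ
    simp only [Finset.mem_univ, if_true, Finset.card_univ, Fintype.card_fin] at B
    have E1 : prob N p x (fun w => (∀ i, localTime x (y i) w % 2 = e i) ∧
        ∀ i, hitsBefore x (y i) w) = EE N p x (fun w => ∏ j, f j (localTime x (y j) w)) := by
      rw [prob_eq]
      refine EE_congr N p x _ _ fun w hw => ?_
      simp only [hits w hw, hfdef, Finset.prod_ite_zero, Finset.prod_const_one, Finset.mem_univ,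
        forall_true_left, ← forall_and]
    have E2 : (1 / 2 ^ k) * prob N p x (fun w => ∀ i, hitsBefore x (y i) w) =
        EE N p x (fun w => ∏ j, g j (localTime x (y j) w)) := by
      rw [prob_eq]
      unfold EE
      rw [← tsum_mul_left]
      change _ = EE N p x _
      have : EE N p x (fun w => ∏ j, g j (localTime x (y j) w)) =
          EE N p x (fun w => (1 / 2 ^ k) * if ∀ i, hitsBefore x (y i) w then 1 else 0) := by
        refine EE_congr N p x _ _ fun w hw => ?_
        simp only [hits w hw, hgdef, Finset.prod_ite_zero, Finset.mem_univ, forall_true_left,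
          Finset.prod_const, Finset.card_univ, Fintype.card_fin]
        split_ifs <;> simp
      rw [this, EE]
      congr 1; ext w; ring
    rw [E1, E2]
    exact B
  · have i0 : Fin k := ⟨0, hk⟩
    have lb := lower_bound N p h0 h1 κ κ0 hκ (y ⟨0, hk⟩) L hL (hy0 _) (hyN _) x hx0 hxN
    refine lb.trans ?_
    have a1 : ∀ z, |mrk 0 0 z| ≤ 1 := by intro z; unfold mrk; split_ifs <;> simp
    have a2 := mrk_abs (y ⟨0, hk⟩) 0 (by simp) _ a1
    unfold UU
    rw [← EE_sub N p p0 h1.le x _ _ ⟨1, pathW_abs _ a1 x⟩ ⟨1, pathW_abs _ a2 x⟩, prob_eq]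
    refine EE_mono N p p0 h1.le x _ _ (Bd.sub ⟨1, pathW_abs _ a1 x⟩ ⟨1, pathW_abs _ a2 x⟩)
      ⟨1, fun w => by dsimp only; split_ifs <;> simp⟩ fun w hw => ?_
    rw [pathW_mul, pathW_mrk, pathW_mrk]
    rcases Nat.eq_zero_or_pos (localTime x 0 w) with hz | hz
    · rcases Nat.eq_zero_or_pos (localTime x (y ⟨0, hk⟩) w) with hv | hv
      · rw [hz, hv]; simp; split_ifs <;> simp
      · have hend : walkPos x w = N := by
          rcases hw.2 with h | h
          · have := localTime_zero_end x w h; omega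
          · exact h
        have : ∀ i, hitsBefore x (y i) w := by
          intro i
          rw [hits w hw i]
          have := hyN i
          exact reach_up2 N x (y ⟨0, hk⟩) (y i) w hend hv (hmono (by simp [Fin.le_def])) (by omega)
        rw [if_pos this, hz, zero_pow hv.ne']; simp
    · rw [zero_pow hz.ne']; simp; split_ifs <;> simp

lemma exists_delta (k : ℕ) (a : Fin k → ℝ) (hmono : StrictMono a)
    (ha0 : ∀ i, 0 < a i) (ha1 : ∀ i, a i < 1)
    (α : ℝ) (hα0 : 0 < α) (hα1 : α < 1) (hne : ∀ i, α ≠ a i) :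
    ∃ δ : ℝ, 0 < δ ∧ (∀ i, δ ≤ a i) ∧ (∀ i, a i ≤ 1 - δ) ∧ δ ≤ α ∧ α ≤ 1 - δ ∧
      (∀ i, δ ≤ |α - a i|) ∧ ∀ i j, i ≠ j → δ ≤ |a i - a j| := by
  have key : ∀ t : ℝ, 0 < t → ∀ᶠ δ in 𝓝[>] (0 : ℝ), δ ≤ t := fun t ht =>
    mem_nhdsWithin_of_mem_nhds (Iic_mem_nhds ht)
  have h1 : ∀ᶠ δ in 𝓝[>] (0 : ℝ), ∀ i, δ ≤ a i := eventually_all.2 fun i => key _ (ha0 i)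
  have h2 : ∀ᶠ δ in 𝓝[>] (0 : ℝ), ∀ i, δ ≤ 1 - a i :=
    eventually_all.2 fun i => key _ (by linarith [ha1 i])
  have h3 := key α hα0
  have h4 := key (1 - α) (by linarith)
  have h5 : ∀ᶠ δ in 𝓝[>] (0 : ℝ), ∀ i, δ ≤ |α - a i| :=
    eventually_all.2 fun i => key _ (abs_pos.2 (sub_ne_zero.2 (hne i)))
  have h6 : ∀ᶠ δ in 𝓝[>] (0 : ℝ), ∀ i j, i ≠ j → δ ≤ |a i - a j| := by
    refine eventually_all.2 fun i => eventually_all.2 fun j => ?_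
    by_cases hij : i = j
    · simp [hij]
    · filter_upwards [key _ (abs_pos.2 (sub_ne_zero.2 (hmono.injective.ne hij)))] with δ h _
      exact h
  have h7 : ∀ᶠ δ in 𝓝[>] (0 : ℝ), 0 < δ := self_mem_nhdsWithin
  obtain ⟨δ, a1, a2, a3, a4, a5, a6, a7⟩ :=
    (h1.and (h2.and (h3.and (h4.and (h5.and (h6.and h7)))))).exists
  exact ⟨δ, a7, a1, fun i => by linarith [a2 i], a3, by linarith, a5, a6⟩

lemma floor_gap (u v δ : ℝ) (N L : ℕ) (hL : (L : ℝ) ≤ δ * N / 2) (hN : 1 ≤ δ * N / 2)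
    (h : δ ≤ |u - v|) : (L : ℤ) ≤ |⌊u * (N : ℝ)⌋ - ⌊v * (N : ℝ)⌋| := by
  have main : ∀ u v : ℝ, δ ≤ u - v → (L : ℤ) ≤ ⌊u * (N : ℝ)⌋ - ⌊v * (N : ℝ)⌋ := by
    intro u v h
    rw [le_sub_iff_add_le, Int.le_floor]
    push_cast
    have h1 := Int.floor_le (v * (N : ℝ))
    have h2 : δ * N ≤ (u - v) * N := mul_le_mul_of_nonneg_right h (Nat.cast_nonneg N)
    linarith
  rcases le_abs.1 h with h | h
  · exact (main u v h).trans (le_abs_self _)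
  · rw [abs_sub_comm]
    exact (main v u (by linarith)).trans (le_abs_self _)

lemma floor_in (u δ : ℝ) (N L : ℕ) (hL : (L : ℝ) ≤ δ * N / 2) (hN : 1 ≤ δ * N / 2)
    (h : δ ≤ u) (h' : u ≤ 1 - δ) : (L : ℤ) ≤ ⌊u * (N : ℝ)⌋ ∧ ⌊u * (N : ℝ)⌋ + (L : ℤ) ≤ N := by
  have hN0 : (0 : ℝ) ≤ N := Nat.cast_nonneg N
  constructor
  · rw [Int.le_floor]
    push_cast
    have := mul_le_mul_of_nonneg_right h hN0
    linarith
  · have h1 := Int.floor_le (u * (N : ℝ))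
    have h2 := mul_le_mul_of_nonneg_right h' hN0
    have : ((⌊u * (N : ℝ)⌋ + (L : ℤ) : ℤ) : ℝ) ≤ ((N : ℤ) : ℝ) := by
      push_cast; linarith
    exact_mod_cast this

lemma kappa_ev (c : ℝ) (hc : 0 ≤ c) : ∀ᶠ N : ℕ in atTop,
    Real.exp (-(4 * c)) / 2 ≤ ((1 - (1 / 2 + c / (N : ℝ))) / (1 / 2 + c / (N : ℝ))) ^ N := by
  have t := Real.tendsto_one_add_div_pow_exp (-(4 * c))
  have e := t.eventually (lt_mem_nhds (half_lt_self (Real.exp_pos (-(4 * c)))))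
  filter_upwards [e, eventually_ge_atTop 1, eventually_ge_atTop ⌈4 * c⌉₊] with N h h1 h2
  refine h.le.trans ?_
  have hN : (0 : ℝ) < N := by exact_mod_cast h1
  have h2' : 4 * c ≤ N := (Nat.le_ceil _).trans (by exact_mod_cast h2)
  have q0 : 0 ≤ c / (N : ℝ) := by positivity
  have q1 : 4 * (c / (N : ℝ)) ≤ 1 := by
    rw [mul_div_assoc', div_le_one hN]; exact h2'
  have e1 : -(4 * c) / (N : ℝ) = -(4 * (c / N)) := by ring
  rw [e1]
  refine pow_le_pow_left₀ (by linarith) ?_ N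
  rw [le_div_iff₀ (by linarith)]
  nlinarith

/-- Proposition 4.1: for the symmetric (`c = 0`) or weakly asymmetric (`c > 0`) walk
with `p_N = 1/2 + c/N`, given that all the sites `⌊α_i N⌋` are visited before exit, the
parities of their local times converge to independent fair Bernoulli variables. -/
theorem parity_iid_fair (c : ℝ) (hc : 0 ≤ c) (k : ℕ) (hk : 1 ≤ k)
    (a : Fin k → ℝ) (hmono : StrictMono a)
    (ha0 : ∀ i, 0 < a i) (ha1 : ∀ i, a i < 1)
    (e : Fin k → ℕ) (he : ∀ i, e i = 0 ∨ e i = 1)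
    (α : ℝ) (hα0 : 0 < α) (hα1 : α < 1) (hne : ∀ i, α ≠ a i) :
    Tendsto (fun N : ℕ =>
        prob N (1/2 + c / (N : ℝ)) ⌊α * (N : ℝ)⌋
            (fun w => (∀ i, localTime ⌊α * (N : ℝ)⌋ ⌊a i * (N : ℝ)⌋ w % 2 = e i) ∧
              ∀ i, hitsBefore ⌊α * (N : ℝ)⌋ ⌊a i * (N : ℝ)⌋ w) /
          prob N (1/2 + c / (N : ℝ)) ⌊α * (N : ℝ)⌋
            (fun w => ∀ i, hitsBefore ⌊α * (N : ℝ)⌋ ⌊a i * (N : ℝ)⌋ w))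
      atTop (𝓝 (1 / 2 ^ k)) := by
  obtain ⟨δ, δ0, d1, d2, d3, d4, d5, d6⟩ := exists_delta k a hmono ha0 ha1 α hα0 hα1 hne
  set κ := Real.exp (-(4 * c)) / 2 with hκdef
  have κ0 : 0 < κ := by positivity
  set K : ℝ := (k * (3 ^ k * (2 / ((δ / 4) * κ)))) / (κ ^ 2 * (δ / 4) ^ 2) with hK
  rw [tendsto_iff_norm_sub_tendsto_zero]
  refine squeeze_zero' (g := fun N : ℕ => K / (N : ℝ)) (Eventually.of_forall fun _ => norm_nonneg _) ?_
    (tendsto_const_div_atTop_nhds_zero_nat K)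
  filter_upwards [kappa_ev c hc, eventually_ge_atTop 1, eventually_ge_atTop (⌈4 * c⌉₊),
    eventually_ge_atTop (⌈4 / δ⌉₊)] with N hκ hN1 hNc hNδ
  have hN : (0 : ℝ) < N := by exact_mod_cast hN1
  have hNc' : 4 * c ≤ N := (Nat.le_ceil _).trans (by exact_mod_cast hNc)
  have hNδ' : 4 / δ ≤ N := (Nat.le_ceil _).trans (by exact_mod_cast hNδ)
  rw [div_le_iff₀ δ0] at hNδ'
  have q0 : 0 ≤ c / (N : ℝ) := by positivity
  have q1 : 4 * (c / (N : ℝ)) ≤ 1 := by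
    rw [mul_div_assoc', div_le_one hN]; exact hNc'
  have hδN : 1 ≤ δ * N / 2 := by linarith
  set L : ℕ := ⌊δ * N / 2⌋₊ with hLdef
  have hL1 : (L : ℝ) ≤ δ * N / 2 := Nat.floor_le (by positivity)
  have hL2 : δ / 4 * N ≤ L := by
    have := Nat.lt_floor_add_one (δ * N / 2)
    rw [← hLdef] at this
    linarith
  have hL0' : (0 : ℝ) < L := lt_of_lt_of_le (by positivity) hL2
  have hL0 : 0 < L := by exact_mod_cast hL0'
  have hx := floor_in α δ N L hL1 hδN d3 d4
  have main := nonasym N (1 / 2 + c / (N : ℝ)) (by linarith) (by linarith) κ κ0 hκ k hk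
    (fun i => ⌊a i * (N : ℝ)⌋) L hL0
    (fun i j hij => Int.floor_mono (mul_le_mul_of_nonneg_right (hmono.monotone hij) hN.le))
    (fun i => (floor_in (a i) δ N L hL1 hδN (d1 i) (d2 i)).1)
    (fun i => (floor_in (a i) δ N L hL1 hδN (d1 i) (d2 i)).2)
    (fun i j hij => floor_gap _ _ δ N L hL1 hδN (d6 i j hij))
    ⌊α * (N : ℝ)⌋ hx.1 hx.2
    (fun i h => by
      have := floor_gap _ _ δ N L hL1 hδN (d5 i)
      rw [h, sub_self, abs_zero] at this
      omega) e he
  obtain ⟨m1, m2⟩ := main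
  set num := prob N (1/2 + c / (N : ℝ)) ⌊α * (N : ℝ)⌋
            (fun w => (∀ i, localTime ⌊α * (N : ℝ)⌋ ⌊a i * (N : ℝ)⌋ w % 2 = e i) ∧
              ∀ i, hitsBefore ⌊α * (N : ℝ)⌋ ⌊a i * (N : ℝ)⌋ w)
  set den := prob N (1/2 + c / (N : ℝ)) ⌊α * (N : ℝ)⌋
            (fun w => ∀ i, hitsBefore ⌊α * (N : ℝ)⌋ ⌊a i * (N : ℝ)⌋ w)
  have hr : δ / 4 ≤ (L : ℝ) / N := by rw [le_div_iff₀ hN]; exact hL2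
  have hden : κ ^ 2 * (δ / 4) ^ 2 ≤ den := by
    refine le_trans ?_ m2
    gcongr
  have hpos : 0 < κ ^ 2 * (δ / 4) ^ 2 := by positivity
  have hden0 : 0 < den := lt_of_lt_of_le hpos hden
  have e1 : num / den - 1 / 2 ^ k = (num - (1 / 2 ^ k) * den) / den := by
    field_simp
  rw [e1, Real.norm_eq_abs, abs_div, abs_of_pos hden0]
  have m3 : |num - (1 / 2 ^ k) * den| ≤ (k * (3 ^ k * (2 / ((δ / 4) * κ)))) / N := by
    refine m1.trans ?_
    have : 2 / ((L : ℝ) * κ) ≤ 2 / ((δ / 4) * κ) / N := by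
      rw [div_div]
      apply div_le_div_of_nonneg_left (by norm_num) (by positivity)
      nlinarith
    calc (k : ℝ) * (3 ^ k * (2 / (L * κ))) ≤ k * (3 ^ k * (2 / ((δ / 4) * κ) / N)) := by gcongr
      _ = _ := by ring
  calc |num - (1 / 2 ^ k) * den| / den
      ≤ ((k * (3 ^ k * (2 / ((δ / 4) * κ)))) / N) / (κ ^ 2 * (δ / 4) ^ 2) := by gcongr
    _ = K / N := by rw [hK, div_right_comm]
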